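/- Under the standing hypotheses, a + 4d ≠ 3^{m-1} + 2^{n-1}. -/

import Mathlib

theorem three_pow_mod_eight (w : ℕ) : 3 ^ w % 8 = 1 ∨ 3 ^ w % 8 = 3 := by
  induction w with
  | zero => simp
  | succ k ih => rw [pow_succ]; omega

theorem three_pow_ne_two_pow_add_one {w t : ℕ} (ht : 4 ≤ t) : 3 ^ w ≠ 2 ^ t + 1 := by
  intro h
  obtain ⟨s, rfl⟩ := Nat.exists_eq_add_of_le ht
  have h5 : ¬ 5 ∣ 2 ^ s := fun hd ↦ by
    have := Nat.Prime.dvd_of_dvd_pow (by norm_num) hd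
    omega
  have key : ∀ w : ℕ, 3 ^ w % 80 = 1 ∨ 3 ^ w % 80 = 3 ∨ 3 ^ w % 80 = 9 ∨ 3 ^ w % 80 = 27 := by
    intro w
    induction w with
    | zero => simp
    | succ k ih => rw [pow_succ]; omega
  have := key w
  rw [pow_add] at h
  omega

theorem two_pow_ne_five_mul_three_pow_add_one {u t : ℕ} (hu : 2 ≤ u) :
    2 ^ t ≠ 5 * 3 ^ u + 1 := by
  intro h
  obtain ⟨s, rfl⟩ := Nat.exists_eq_add_of_le hu
  have h7 : ¬ 7 ∣ 3 ^ s := fun hd ↦ by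
    have := Nat.Prime.dvd_of_dvd_pow (by norm_num) hd
    omega
  have key : ∀ t : ℕ, 2 ^ t % 63 = 1 ∨ 2 ^ t % 63 = 2 ∨ 2 ^ t % 63 = 4 ∨ 2 ^ t % 63 = 8 ∨
      2 ^ t % 63 = 16 ∨ 2 ^ t % 63 = 32 := by
    intro t
    induction t with
    | zero => simp
    | succ k ih => rw [pow_succ]; omega
  have := key t
  rw [pow_add] at h
  omega

theorem two_pow_mod_three_ne_zero (t : ℕ) : 2 ^ t % 3 ≠ 0 := by
  induction t with
  | zero => simp
  | succ k ih => rw [pow_succ]; omega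

set_option maxHeartbeats 800000 in
/-- Under the standing hypotheses, a + 4d ≠ 3^(m-1) + 2^(n-1). -/
theorem a3_ne_weak_weak (a d m n : ℕ)
    (ha : 0 < a) (hd : 0 < d)
    (hAP : ∀ i : ℕ, i ≤ 6 → ∃ x y : ℕ, a + i * d = 3 ^ x + 2 ^ y)
    (hbig : 3 ^ 9 ≤ a + 6 * d)
    (hm₁ : 3 ^ m ≤ a + 6 * d) (hm₂ : a + 6 * d < 3 ^ (m + 1))
    (hn₁ : 2 ^ n ≤ a + 6 * d) (hn₂ : a + 6 * d < 2 ^ (n + 1)) :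
    a + 4 * d ≠ 3 ^ (m - 1) + 2 ^ (n - 1) := by
  intro h4
  have hm : 9 ≤ m := by
    have : 9 < m + 1 := (Nat.pow_lt_pow_iff_right (a := 3) (by norm_num)).1 (by omega)
    omega
  have hn : 14 ≤ n := by
    have : 14 < n + 1 := (Nat.pow_lt_pow_iff_right (a := 2) (by norm_num)).1
      (by norm_num at hbig ⊢; omega)
    omega
  obtain ⟨w, rfl⟩ := Nat.exists_eq_add_of_le' hm
  obtain ⟨k, rfl⟩ := Nat.exists_eq_add_of_le' hn
  obtain ⟨x6, y6, h6⟩ := hAP 6 (by norm_num)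
  obtain ⟨x5, y5, h5⟩ := hAP 5 (by norm_num)
  have pow_w9 : 3 ^ (w + 9) = 3 * 3 ^ (w + 8) := by ring
  have pow_w10 : 3 ^ (w + 9 + 1) = 9 * 3 ^ (w + 8) := by ring
  have pow_w8 : 3 ^ (w + 8) = 3 * 3 ^ (w + 7) := by ring
  have pow_k14 : 2 ^ (k + 14) = 4 * 2 ^ (k + 12) := by ring
  have pow_k12 : 2 ^ (k + 12) = 4096 * 2 ^ k := by ring
  have pow_k13 : 2 ^ (k + 13) = 2 * 2 ^ (k + 12) := by ring
  have pow_k15 : 2 ^ (k + 14 + 1) = 8 * 2 ^ (k + 12) := by ring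
  have m8 := three_pow_mod_eight (w + 8)
  have m3 := two_pow_mod_three_ne_zero (k + 12)
  simp only [show w + 9 - 1 = w + 8 by omega, show k + 14 - 1 = k + 13 by omega] at h4
  -- the two shapes available to a term larger than `a + 4 * d`
  have shape : ∀ x y : ℕ, a + 4 * d < 3 ^ x + 2 ^ y → 3 ^ x + 2 ^ y ≤ a + 6 * d →
      (x = w + 9 ∧ y < k + 14) ∨ (x < w + 9 ∧ y = k + 14) := by
    intro x y hl hu
    have px : 0 < 3 ^ x := by positivity
    have py : 0 < 2 ^ y := by positivity
    have hx : x < w + 9 + 1 :=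
      (Nat.pow_lt_pow_iff_right (a := 3) (by norm_num)).1 (by omega)
    have hy : y < k + 14 + 1 :=
      (Nat.pow_lt_pow_iff_right (a := 2) (by norm_num)).1 (by omega)
    by_cases hx' : x = w + 9
    · refine .inl ⟨hx', ?_⟩
      by_contra hy'
      obtain rfl : y = k + 14 := by omega
      subst hx'
      omega
    · refine .inr ⟨by omega, ?_⟩
      by_contra hy'
      have h1 : 3 ^ x ≤ 3 ^ (w + 8) := Nat.pow_le_pow_right (by norm_num) (by omega)
      have h2 : 2 ^ y ≤ 2 ^ (k + 13) := Nat.pow_le_pow_right (by norm_num) (by omega)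
      omega
  rcases shape x6 y6 (by omega) (by omega) with ⟨rfl, hy6⟩ | ⟨hx6, rfl⟩ <;>
  rcases shape x5 y5 (by omega) (by omega) with ⟨rfl, hy5⟩ | ⟨hx5, rfl⟩
  · have hlt : y5 < y6 := (Nat.pow_lt_pow_iff_right (a := 2) (by norm_num)).1 (by omega)
    have E : 2 * 3 ^ (w + 8) + 2 * 2 ^ y5 = 2 ^ y6 + 2 ^ (k + 13) := by omega
    obtain ⟨z, rfl⟩ : ∃ z, y6 = z + 1 := ⟨y6 - 1, by omega⟩
    rw [pow_succ] at E
    rcases y5 with _ | y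
    · rcases z with _ | _ | _ | z
      · omega
      · exact three_pow_ne_two_pow_add_one (w := w + 8) (t := k + 12) (by omega) (by omega)
      · omega
      · have : 2 ^ (z + 1 + 1 + 1) = 8 * 2 ^ z := by ring
        omega
    · obtain ⟨z, rfl⟩ : ∃ z', z = z' + 1 := ⟨z - 1, by omega⟩
      rw [pow_succ, pow_succ] at E
      omega
  · have E : 2 * 3 ^ x5 + 3 * 2 ^ (k + 13) = 4 * 3 ^ (w + 8) + 2 ^ y6 := by omega
    have := three_pow_mod_eight x5
    rcases y6 with _ | _ | y
    · omega
    · rcases x5 with _ | x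
      · omega
      · rw [pow_succ] at E
        omega
    · have : 2 ^ (y + 1 + 1) = 4 * 2 ^ y := by ring
      omega
  · have E : 3 * 2 ^ (k + 13) + 3 ^ x6 = 5 * 3 ^ (w + 8) + 2 * 2 ^ y5 := by omega
    have := two_pow_mod_three_ne_zero y5
    rcases x6 with _ | x
    · rcases y5 with _ | _ | y
      · omega
      · exact two_pow_ne_five_mul_three_pow_add_one (u := w + 7) (t := k + 13) (by omega)
          (by omega)
      · have : 2 ^ (y + 1 + 1) = 4 * 2 ^ y := by ring
        omega
    · rw [pow_succ] at E
      omega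
  · have hlt : x5 < x6 := (Nat.pow_lt_pow_iff_right (a := 3) (by norm_num)).1 (by omega)
    have E : 3 ^ x6 + 3 ^ (w + 8) = 2 ^ (k + 13) + 2 * 3 ^ x5 := by omega
    rcases x5 with _ | x
    · rcases Nat.lt_or_ge x6 (w + 8) with hv | hv
      · have : 3 ^ x6 ≤ 3 ^ (w + 7) := Nat.pow_le_pow_right (by norm_num) (by omega)
        omega
      · obtain rfl : x6 = w + 8 := by omega
        exact three_pow_ne_two_pow_add_one (w := w + 8) (t := k + 12) (by omega) (by omega)
    · obtain ⟨z, rfl⟩ : ∃ z, x6 = z + 1 := ⟨x6 - 1, by omega⟩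
      rw [pow_succ, pow_succ] at E
      clear * - E pow_w8 pow_k13 m3
      omega
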